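/- arXiv:1310.2701 — 2 statements merged into one kernel-verified Lean document; each statement's English description precedes it below -/
import Mathlib

section
/- Let p be a real polynomial in n variables and let d be a natural number. If there exists a positive semidefinite real symmetric matrix Q, indexed by the monomials of degree at most d in n variables, such that p(x) = Z(x)ᵀ Q Z(x) for all x ∈ ℝⁿ, where Z(x) is the vector of all monomials of degree at most d evaluated at x, then p is a sum of squares of polynomials. -/
open MvPolynomial Matrix

/-- The finite set of monomial exponent vectors in `n` variables of total degree at most `d`. -/
noncomputable def monomialsUpTo (n d : ℕ) : Finset (Fin n →₀ ℕ) := by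
  classical
  exact (Finset.Iic (Finsupp.equivFunOnFinite.symm fun _ : Fin n => d)).filter
    (fun m => (m.sum fun _ e => e) ≤ d)

/-- The vector `Z(x)` of all monomials of degree at most `d` evaluated at `x`. -/
noncomputable def monomialVec (n d : ℕ) (x : Fin n → ℝ) : ↥(monomialsUpTo n d) → ℝ :=
  fun m => ∏ i, x i ^ ((m : Fin n →₀ ℕ) i)

/-- The polynomial with coefficient vector `v` evaluates to the pairing of `v` with the
monomial vector. -/
theorem eval_sum_monomial_eq_dotProduct_monomialVec (n d : ℕ) (v : ↥(monomialsUpTo n d) → ℝ)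
    (x : Fin n → ℝ) :
    eval x (∑ m : ↥(monomialsUpTo n d), monomial (m : Fin n →₀ ℕ) (v m)) =
      v ⬝ᵥ monomialVec n d x := by
  simp [dotProduct, monomialVec, eval_monomial, Finsupp.prod_fintype]

/-- If `p(x) = Z(x)ᵀ Q Z(x)` for a positive semidefinite symmetric matrix `Q` indexed by the
monomials of degree at most `d`, then `p` is a sum of squares of polynomials. -/
theorem gram_matrix_psd_implies_sos (n d : ℕ) (p : MvPolynomial (Fin n) ℝ)
    (Q : Matrix ↥(monomialsUpTo n d) ↥(monomialsUpTo n d) ℝ)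
    (hQ : Q.PosSemidef)
    (hrep : ∀ x : Fin n → ℝ,
      eval x p = monomialVec n d x ⬝ᵥ Q.mulVec (monomialVec n d x)) :
    ∃ (N : ℕ) (f : Fin N → MvPolynomial (Fin n) ℝ), p = ∑ i, (f i) ^ 2 := by
  obtain ⟨N, v, rfl⟩ := posSemidef_iff_eq_sum_vecMulVec.mp hQ
  refine ⟨N, fun i => ∑ m : ↥(monomialsUpTo n d), monomial (m : Fin n →₀ ℕ) (v i m),
    MvPolynomial.funext fun x => ?_⟩
  rw [hrep, sum_mulVec, dotProduct_sum, map_sum]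
  refine Finset.sum_congr rfl fun i _ => ?_
  rw [map_pow, eval_sum_monomial_eq_dotProduct_monomialVec, vecMulVec_mulVec, star_trivial,
    op_smul_eq_smul, dotProduct_smul, smul_eq_mul, dotProduct_comm _ (v i), sq]
end

section
/- Let p be a real polynomial in n variables of total degree at most 2d. If p is a sum of squares of polynomials, then there exists a positive semidefinite real symmetric matrix Q, indexed by the monomials of degree at most d in n variables, such that p(x) = Z(x)ᵀ Q Z(x) for all x ∈ ℝⁿ, where Z(x) is the vector of all monomials of degree at most d evaluated at x. -/
open MvPolynomial Matrix

/-- There is no cancellation of leading terms in a sum of squares over `ℝ`, so each summand has at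
most half the total degree of the sum. -/
theorem two_mul_totalDegree_le_totalDegree_sum_sq {σ ι : Type*} [LinearOrder σ] [WellFoundedGT σ]
    (s : Finset ι) (f : ι → MvPolynomial σ ℝ) {i : ι} (hi : i ∈ s) :
    2 * (f i).totalDegree ≤ (∑ j ∈ s, f j ^ 2).totalDegree := by
  obtain ⟨k, hk, hmax⟩ := s.exists_max_image
    (fun j => MonomialOrder.degLex.toSyn (MonomialOrder.degLex.degree (f j))) ⟨i, hi⟩
  have hik : (f i).totalDegree ≤ (f k).totalDegree := degLex_totalDegree_monotone (hmax i hi)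
  by_cases hfk : f k = 0
  · rw [hfk, totalDegree_zero] at hik
    lia
  set a := MonomialOrder.degLex.degree (f k) with ha
  have hcoeff : coeff (a + a) (∑ j ∈ s, f j ^ 2) = ∑ j ∈ s, coeff a (f j) ^ 2 := by
    rw [coeff_sum]
    refine Finset.sum_congr rfl fun j hj => ?_
    rw [sq, sq, MonomialOrder.degLex.coeff_mul_of_add_of_degree_le (hmax j hj) (hmax j hj)]
  have hlead : coeff a (f k) ≠ 0 := MonomialOrder.degLex.leadingCoeff_ne_zero_iff.mpr hfk
  have hpos : 0 < ∑ j ∈ s, coeff a (f j) ^ 2 :=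
    Finset.sum_pos' (fun j _ => sq_nonneg _) ⟨k, hk, by positivity⟩
  have hle : (a + a).degree ≤ (∑ j ∈ s, f j ^ 2).totalDegree :=
    le_totalDegree (mem_support_iff.mpr (hcoeff ▸ hpos.ne'))
  rw [map_add, ha, degree_degLexDegree] at hle
  lia

theorem mem_monomialsUpTo {n d : ℕ} {m : Fin n →₀ ℕ} :
    m ∈ monomialsUpTo n d ↔ m.degree ≤ d := by
  simp only [monomialsUpTo, Finset.mem_filter, Finset.mem_Iic]
  exact ⟨fun h => h.2, fun h => ⟨fun i => (Finsupp.le_degree i m).trans h, h⟩⟩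

/-- A polynomial of total degree at most `d` is evaluated by pairing its coefficient vector with the
vector of monomials. -/
theorem eval_eq_dotProduct_monomialVec {n d : ℕ} {f : MvPolynomial (Fin n) ℝ}
    (hf : f.totalDegree ≤ d) (x : Fin n → ℝ) :
    eval x f = (fun m : ↥(monomialsUpTo n d) => coeff (m : Fin n →₀ ℕ) f) ⬝ᵥ
      monomialVec n d x := by
  have hsub : f.support ⊆ monomialsUpTo n d := fun m hm =>
    mem_monomialsUpTo.mpr ((le_totalDegree hm).trans hf)
  rw [eval_eq', Finset.sum_subset hsub fun m _ hm => by rw [notMem_support_iff.mp hm, zero_mul],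
    ← Finset.sum_coe_sort]
  rfl

/-- If `p` has total degree at most `2d` and is a sum of squares of polynomials, then there is a
positive semidefinite symmetric matrix `Q`, indexed by the monomials of degree at most `d`,
such that `p(x) = Z(x)ᵀ Q Z(x)` for all `x`. -/
theorem sos_implies_gram_matrix_psd (n d : ℕ) (p : MvPolynomial (Fin n) ℝ)
    (hdeg : p.totalDegree ≤ 2 * d)
    (hsos : ∃ (N : ℕ) (f : Fin N → MvPolynomial (Fin n) ℝ), p = ∑ i, (f i) ^ 2) :
    ∃ Q : Matrix ↥(monomialsUpTo n d) ↥(monomialsUpTo n d) ℝ,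
      Q.PosSemidef ∧
      ∀ x : Fin n → ℝ,
        eval x p = monomialVec n d x ⬝ᵥ Q.mulVec (monomialVec n d x) := by
  obtain ⟨N, f, rfl⟩ := hsos
  have hf (i : Fin N) : (f i).totalDegree ≤ d := by
    have := two_mul_totalDegree_le_totalDegree_sum_sq Finset.univ f (Finset.mem_univ i)
    lia
  let C : Matrix (Fin N) ↥(monomialsUpTo n d) ℝ := .of fun i m => coeff (m : Fin n →₀ ℕ) (f i)
  refine ⟨Cᴴ * C, posSemidef_conjTranspose_mul_self C, fun x => ?_⟩
  have hC : C *ᵥ monomialVec n d x = fun i => eval x (f i) :=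
    funext fun i => (eval_eq_dotProduct_monomialVec (hf i) x).symm
  rw [← mulVec_mulVec, dotProduct_mulVec, conjTranspose_eq_transpose_of_trivial, vecMul_transpose,
    hC]
  simp [dotProduct, sq]
end
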